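/- arXiv:1103.5185 — 10 statements merged into one kernel-verified Lean document; each statement's English description precedes it below -/
import Mathlib

section
/- Let n > q > 0 be coprime integers with Hirzebruch–Jung data (l; b_1, …, b_l; (p_i); (q_i)). Then Σ_{i=1}^{l} (p_i + q_i)·(2 − b_i) = q + p_l + 2 − 2n. Moreover, 0 < p_l < n and q·p_l ≡ 1 (mod n), i.e., p_l is the unique representative in (0, n) of the multiplicative inverse of q modulo n. -/
/-- Hirzebruch–Jung data for the pair `(n, q)`: an integer `l ≥ 1`, the entries
`b i ≥ 2` (for `1 ≤ i ≤ l`) of the Hirzebruch–Jung continued fraction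
`n/q = [b_1, …, b_l]`, and the integer sequences `p i`, `s i` (for `0 ≤ i ≤ l+1`,
with `s` playing the role of the `q_i` of the paper) satisfying
`p_0 = 0`, `p_1 = 1`, `q_0 = n`, `q_1 = q`, the recurrences
`p_{i+1} = b_i p_i − p_{i−1}`, `q_{i+1} = b_i q_i − q_{i−1}`, and
`n = q_0 > q_1 > ⋯ > q_l = 1 > q_{l+1} = 0`. -/
structure HJData (n q : ℤ) where
  l : ℕ
  b : ℕ → ℤ
  p : ℕ → ℤ
  s : ℕ → ℤ
  hl : 1 ≤ l
  hb : ∀ i, 1 ≤ i → i ≤ l → 2 ≤ b i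
  hp0 : p 0 = 0
  hp1 : p 1 = 1
  hs0 : s 0 = n
  hs1 : s 1 = q
  hrecp : ∀ i, 1 ≤ i → i ≤ l → p (i + 1) = b i * p i - p (i - 1)
  hrecs : ∀ i, 1 ≤ i → i ≤ l → s (i + 1) = b i * s i - s (i - 1)
  hsdec : ∀ i, i ≤ l → s (i + 1) < s i
  hsl : s l = 1
  hslast : s (l + 1) = 0

/-- The key computation in the proof of Lemma `lem:dnaInteger` of the paper:
`Σ_{i=1}^{l} (p_i + q_i)(2 − b_i) = q + p_l + 2 − 2n`, and `p_l` is the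
unique representative in `(0, n)` of the multiplicative inverse of `q`
modulo `n`. -/
theorem hj_sum_identity (n q : ℤ) (hq : 0 < q) (hqn : q < n)
    (hcop : IsCoprime n q) (D : HJData n q) :
    (∑ i ∈ Finset.Icc 1 D.l, (D.p i + D.s i) * (2 - D.b i))
        = q + D.p D.l + 2 - 2 * n ∧
    0 < D.p D.l ∧ D.p D.l < n ∧ n ∣ q * D.p D.l - 1 ∧
    ∀ x : ℤ, 0 < x → x < n → n ∣ q * x - 1 → x = D.p D.l := by
  have key : ∀ k, k ≤ D.l →
      (0 ≤ D.p k ∧ D.p k < D.p (k + 1)) ∧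
      D.p (k + 1) * D.s k - D.p k * D.s (k + 1) = n ∧
      (n ∣ q * D.p k - D.s k ∧ n ∣ q * D.p (k + 1) - D.s (k + 1)) ∧
      (∑ i ∈ Finset.Icc 1 k, (D.p i + D.s i) * (2 - D.b i))
        = 1 + q - n - (D.p (k + 1) + D.s (k + 1)) + (D.p k + D.s k) := by
    intro k
    induction k with
    | zero =>
      intro _
      simp [D.hp0, D.hp1, D.hs0, D.hs1]
    | succ k ih =>
      intro hk
      obtain ⟨⟨h1, h2⟩, h3, ⟨h4, h5⟩, h6⟩ := ih (by omega)
      have hb := D.hb (k + 1) (by omega) hk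
      have rp := D.hrecp (k + 1) (by omega) hk
      have rs := D.hrecs (k + 1) (by omega) hk
      simp only [Nat.add_sub_cancel] at rp rs
      refine ⟨⟨by omega, ?_⟩, ?_, ⟨h5, ?_⟩, ?_⟩
      · rw [rp]; nlinarith
      · rw [rp, rs]; linarith
      · rw [rp, rs]
        have := dvd_sub (h5.mul_left (D.b (k + 1))) h4
        have e : q * (D.b (k + 1) * D.p (k + 1) - D.p k) - (D.b (k + 1) * D.s (k + 1) - D.s k)
            = D.b (k + 1) * (q * D.p (k + 1) - D.s (k + 1)) - (q * D.p k - D.s k) := by ring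
        rw [e]; exact this
      · rw [Finset.sum_Icc_succ_top (by omega), h6, rp, rs]; ring
  obtain ⟨⟨h1, h2⟩, h3, ⟨h4, h5⟩, h6⟩ := key D.l le_rfl
  rw [D.hsl, D.hslast] at h3 h6
  rw [D.hsl] at h4
  have hn : D.p (D.l + 1) = n := by linarith
  have hne : D.p D.l ≠ 0 := by
    intro h0
    rw [h0] at h4
    have h7 : n ∣ 1 := by simpa using h4
    have := Int.le_of_dvd one_pos h7
    omega
  refine ⟨by rw [h6, hn]; ring, by omega, by omega, h4, ?_⟩
  intro x hx hxn hd
  have h8 : n ∣ q * (x - D.p D.l) := by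
    have := dvd_sub hd h4
    have e : q * (x - D.p D.l) = q * x - 1 - (q * D.p D.l - 1) := by ring
    rw [e]; exact this
  have h9 : n ∣ x - D.p D.l := hcop.dvd_of_dvd_mul_left h8
  have := Int.eq_zero_of_abs_lt_dvd h9 (by rw [abs_lt]; constructor <;> omega)
  omega
end

section
/- Let n > q > 0 be coprime integers. Then n divides (q + 1)² if and only if either n = q + 1, or there exist positive integers d, m, a with m > a, gcd(m, a) = 1, n = d·m², and q + 1 = d·m·a. -/
/-- The number-theoretic heart of Lemma `lem:dnaInteger` of the paper: for
coprime integers `n > q > 0`, `n` divides `(q + 1)²` if and only if either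
`n = q + 1`, or there exist positive integers `d`, `m`, `a` with `m > a`,
`gcd(m, a) = 1`, `n = d·m²` and `q + 1 = d·m·a`. -/
theorem dvd_sq_iff_classT (n q : ℤ) (hq : 0 < q) (hqn : q < n)
    (hcop : IsCoprime n q) :
    n ∣ (q + 1) ^ 2 ↔
      n = q + 1 ∨
        ∃ d m a : ℤ, 0 < d ∧ 0 < a ∧ a < m ∧ IsCoprime m a ∧
          n = d * m ^ 2 ∧ q + 1 = d * m * a := by
  constructor
  · intro h
    by_cases hn : n = q + 1
    · exact Or.inl hn
    right
    have hlt : q + 1 < n := by omega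
    have hg : 0 < Int.gcd n (q + 1) := Int.gcd_pos_of_ne_zero_left _ (by omega)
    obtain ⟨m, a, hma, h1, h2⟩ := Int.exists_gcd_one hg
    generalize hG : ((Int.gcd n (q + 1) : ℕ) : ℤ) = g at h1 h2
    have hg' : 0 < g := by rw [← hG]; exact_mod_cast hg
    have hc : IsCoprime m a := Int.isCoprime_iff_gcd_eq_one.mpr hma
    have hdvd : m ∣ g := by
      rw [h1, h2] at h
      have h3 : g * m ∣ g * (g * a ^ 2) := by
        convert h using 1 <;> ring
      have h4 : m ∣ g * a ^ 2 := (mul_dvd_mul_iff_left hg'.ne').mp h3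
      exact (hc.pow_right).dvd_of_dvd_mul_right h4
    obtain ⟨d, hd⟩ := hdvd
    have ha : 0 < a := by
      have : 0 < a * g := by omega
      exact pos_of_mul_pos_left this hg'.le
    have ham : a < m := by
      have : a * g < m * g := by omega
      exact lt_of_mul_lt_mul_right this hg'.le
    have hm : 0 < m := ha.trans ham
    refine ⟨d, m, a, ?_, ha, ham, hc, ?_, ?_⟩
    · rw [hd] at hg'
      exact pos_of_mul_pos_right hg' hm.le
    · rw [h1, hd]; ring
    · rw [h2, hd]; ring
  · rintro (h | ⟨d, m, a, -, -, -, -, h1, h2⟩)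
    · rw [h]; exact Dvd.intro_left (q + 1) (by ring)
    · rw [h1, h2]; exact ⟨d * a ^ 2, by ring⟩
end

section
/- Let (d, n, a) be a class-T triple, with Hirzebruch–Jung data (l; b_1, …, b_l; (p_i); (q_i)) for the pair (dn², dna − 1), and set r_i := (p_i + q_i)/(dn). Then dn divides p_i + q_i for all 0 ≤ i ≤ l + 1, so each r_i is an integer; r_0 = r_{l+1} = n and r_1 = a; and for all 1 ≤ i ≤ l one has 1 ≤ r_i ≤ n − 1, r_i ≡ a·p_i (mod n), and r_i ≡ −a·q_i (mod n). -/
/-- Lemma `lem:ripl`, items (1) and (2), of the paper: for a class-T triple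
`(d, n, a)` and the Hirzebruch–Jung data of the pair `(dn², dna − 1)`,
`dn` divides `p_i + q_i` for all `0 ≤ i ≤ l+1`, and the integers
`r_i = (p_i + q_i)/(dn)` satisfy `r_0 = r_{l+1} = n`, `r_1 = a`, and
`1 ≤ r_i ≤ n − 1`, `r_i ≡ a·p_i (mod n)`, `r_i ≡ −a·q_i (mod n)`
for `1 ≤ i ≤ l`. -/
theorem hj_classT_r (d n a : ℤ) (hd : 0 < d) (ha : 0 < a) (han : a < n)
    (hcop : IsCoprime n a) (D : HJData (d * n ^ 2) (d * n * a - 1)) :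
    ∃ r : ℕ → ℤ,
      (∀ i, i ≤ D.l + 1 → D.p i + D.s i = d * n * r i) ∧
      r 0 = n ∧ r (D.l + 1) = n ∧ r 1 = a ∧
      ∀ i, 1 ≤ i → i ≤ D.l →
        1 ≤ r i ∧ r i ≤ n - 1 ∧ n ∣ r i - a * D.p i ∧ n ∣ r i + a * D.s i := by
  have hn : 0 < n := by omega
  have hdn : d * n ≠ 0 := by positivity
  have hdnp : 0 < d * n := by positivity
  obtain ⟨l, b, p, s, hl, hb, hp0, hp1, hs0, hs1, hrecp, hrecs, hsdec, hsl, hslast⟩ := D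
  dsimp only
  -- divisibility
  have hdvd : ∀ i, i ≤ l → d * n ∣ p i + s i ∧ d * n ∣ p (i + 1) + s (i + 1) := by
    intro i
    induction i with
    | zero =>
      intro _
      refine ⟨⟨n, ?_⟩, ⟨a, ?_⟩⟩
      · rw [hp0, hs0]; ring
      · rw [zero_add, hp1, hs1]; ring
    | succ i ih =>
      intro hi
      obtain ⟨⟨x, hx⟩, ⟨y, hy⟩⟩ := ih (by omega)
      refine ⟨⟨y, hy⟩, ⟨b (i + 1) * y - x, ?_⟩⟩
      have h1 := hrecp (i + 1) (by omega) hi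
      have h2 := hrecs (i + 1) (by omega) hi
      rw [Nat.add_sub_cancel] at h1 h2
      rw [h1, h2]
      linear_combination b (i + 1) * hy - hx
  have hdvd2 : ∀ i, ∃ x, i ≤ l + 1 → p i + s i = d * n * x := by
    intro i
    by_cases hi : i ≤ l + 1
    · rcases Nat.lt_or_ge l i with h | h
      · obtain rfl : i = l + 1 := by omega
        obtain ⟨x, hx⟩ := (hdvd l le_rfl).2
        exact ⟨x, fun _ => hx⟩
      · obtain ⟨x, hx⟩ := (hdvd i h).1
        exact ⟨x, fun _ => hx⟩
    · exact ⟨0, fun h => absurd h hi⟩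
  choose r hr using hdvd2
  have hdet : ∀ i, i ≤ l → s i * p (i + 1) - s (i + 1) * p i = d * n ^ 2 := by
    intro i
    induction i with
    | zero => intro _; rw [zero_add, hp0, hp1, hs0]; ring
    | succ i ih =>
      intro hi
      have h1 := hrecp (i + 1) (by omega) hi
      have h2 := hrecs (i + 1) (by omega) hi
      rw [Nat.add_sub_cancel] at h1 h2
      rw [h1, h2]
      linear_combination ih (by omega)
  have hpinc : ∀ i, i ≤ l → 0 ≤ p i ∧ p i + 1 ≤ p (i + 1) := by
    intro i
    induction i with
    | zero => intro _; rw [zero_add, hp0, hp1]; omega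
    | succ i ih =>
      intro hi
      have h1 := hrecp (i + 1) (by omega) hi
      rw [Nat.add_sub_cancel] at h1
      obtain ⟨h3, h4⟩ := ih (by omega)
      have h5 := hb (i + 1) (by omega) hi
      refine ⟨by omega, ?_⟩
      rw [h1]
      nlinarith
  have hspos : ∀ j i, i + j = l → 1 ≤ s i := by
    intro j
    induction j with
    | zero => intro i hi; obtain rfl : i = l := by omega
              omega
    | succ j ih =>
      intro i hi
      have := ih (i + 1) (by omega)
      have := hsdec i (by omega)
      omega
  have hr0 : r 0 = n := by
    have := hr 0 (by omega)
    apply mul_left_cancel₀ hdn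
    rw [← this, hp0, hs0]; ring
  have hr1 : r 1 = a := by
    have := hr 1 (by omega)
    apply mul_left_cancel₀ hdn
    rw [← this, hp1, hs1]; ring
  have hrl : r (l + 1) = n := by
    have := hr (l + 1) le_rfl
    have h := hdet l le_rfl
    rw [hsl, hslast] at h
    apply mul_left_cancel₀ hdn
    rw [← this, hslast]; linear_combination h
  have hcong : ∀ i, i ≤ l → n ∣ r i - a * p i ∧ n ∣ r (i + 1) - a * p (i + 1) := by
    intro i
    induction i with
    | zero => intro _; rw [zero_add, hr0, hr1, hp0, hp1]; simp
    | succ i ih =>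
      intro hi
      obtain ⟨⟨x, hx⟩, ⟨y, hy⟩⟩ := ih (by omega)
      refine ⟨⟨y, hy⟩, ⟨b (i + 1) * y - x, ?_⟩⟩
      have h1 := hrecp (i + 1) (by omega) hi
      have h2 := hrecs (i + 1) (by omega) hi
      rw [Nat.add_sub_cancel] at h1 h2
      have h3 : r (i + 1 + 1) = b (i + 1) * r (i + 1) - r i := by
        apply mul_left_cancel₀ hdn
        rw [← hr (i + 1 + 1) (by omega), h1, h2]
        linear_combination b (i + 1) * hr (i + 1) (by omega) - hr i (by omega)
      rw [h1, h3]
      linear_combination b (i + 1) * hy - hx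
  refine ⟨r, hr, hr0, hrl, hr1, ?_⟩
  intro i hi1 hil
  have hri := hr i (by omega)
  have hs := hspos (l - i) i (by omega)
  obtain ⟨hp, hpi⟩ := hpinc i hil
  have hsd := hsdec i hil
  have hdt := hdet i hil
  obtain ⟨hc1, hc2⟩ := hcong i hil
  refine ⟨?_, ?_, hc1, ?_⟩
  · have : 0 < d * n * r i := by omega
    have := pos_of_mul_pos_right this hdnp.le
    omega
  · by_contra hcon
    have hge : n ≤ r i := by omega
    have hge2 : d * n ^ 2 ≤ p i + s i := by
      rw [hri]; nlinarith
    have e1 : 0 ≤ s i * (p (i + 1) - p i - 1) := mul_nonneg (by omega) (by omega)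
    have e2 : 0 ≤ (s i - 1 - s (i + 1)) * p i := mul_nonneg (by omega) hp
    have hpp : 1 ≤ p i := by
      obtain ⟨k, rfl⟩ : ∃ k, i = k + 1 := ⟨i - 1, by omega⟩
      have := hpinc k (by omega)
      omega
    have f1 : s i * (p (i + 1) - p i - 1) = 0 := by nlinarith
    have f2 : (s i - 1 - s (i + 1)) * p i = 0 := by nlinarith
    have f1' : p (i + 1) - p i - 1 = 0 := (mul_eq_zero.mp f1).resolve_left (by omega)
    have f2' : s i - 1 - s (i + 1) = 0 := (mul_eq_zero.mp f2).resolve_right (by omega)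
    have g : p i + s i = d * n ^ 2 := by linear_combination hdt - f1 - f2
    have k1 : r i = n := by
      apply mul_left_cancel₀ hdn
      rw [← hri, g]; ring
    have k2 : r (i + 1) = n := by
      apply mul_left_cancel₀ hdn
      rw [← hr (i + 1) (by omega)]
      linear_combination g + f1' - f2'
    rw [k1] at hc1
    rw [k2] at hc2
    have m : n ∣ a := by
      have := dvd_sub hc1 hc2
      have e : n - a * p i - (n - a * p (i + 1)) = a := by linear_combination a * f1'
      rwa [e] at this
    have := Int.le_of_dvd ha m
    omega
  · have e : r i + a * s i = (r i - a * p i) + n * (a * d * r i) := by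
      linear_combination a * hri
    rw [e]
    exact dvd_add hc1 (dvd_mul_right _ _)
end

section
/- Let (d, n, a) be a class-T triple, with Hirzebruch–Jung data (l; b_1, …, b_l; (p_i); (q_i)) for the pair (dn², dna − 1), and set r_i := (p_i + q_i)/(dn). Then r_l = n − a; equivalently, p_l = dn(n − a) − 1. -/
/-- Lemma `lem:ripl`, item (3), of the paper: for a class-T triple
`(d, n, a)` and the Hirzebruch–Jung data of the pair `(dn², dna − 1)`,
one has `r_l = n − a` (i.e. `p_l + q_l = dn(n − a)`), equivalently
`p_l = dn(n − a) − 1`. -/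
theorem hj_classT_rl (d n a : ℤ) (hd : 0 < d) (ha : 0 < a) (han : a < n)
    (hcop : IsCoprime n a) (D : HJData (d * n ^ 2) (d * n * a - 1)) :
    D.p D.l + D.s D.l = d * n * (n - a) ∧ D.p D.l = d * n * (n - a) - 1 := by
  have key : ∀ i, i ≤ D.l → (0 ≤ D.p i ∧ D.p i < D.p (i+1)) ∧
      D.p (i+1) * D.s i - D.p i * D.s (i+1) = d * n ^ 2 ∧
      (d * n ^ 2 ∣ (d * n * a - 1) * D.p i - D.s i) ∧
      (d * n ^ 2 ∣ (d * n * a - 1) * D.p (i+1) - D.s (i+1)) := by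
    intro i
    induction i with
    | zero =>
      intro _
      simp [D.hp0, D.hp1, D.hs0, D.hs1]
    | succ k ih =>
      intro hk
      obtain ⟨⟨h1, h2⟩, h3, h4, h5⟩ := ih (by omega)
      have hp := D.hrecp (k+1) (by omega) hk
      have hs := D.hrecs (k+1) (by omega) hk
      have hb := D.hb (k+1) (by omega) hk
      simp only [Nat.add_sub_cancel] at hp hs
      refine ⟨⟨by omega, ?_⟩, ?_, h5, ?_⟩
      · rw [hp]; nlinarith
      · rw [hp, hs]; linarith
      · rw [hp, hs]
        obtain ⟨u, hu⟩ := h5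
        obtain ⟨v, hv⟩ := h4
        exact ⟨D.b (k+1) * u - v, by linear_combination D.b (k+1) * hu - hv⟩
  obtain ⟨⟨h1, h2⟩, h3, h4, -⟩ := key D.l le_rfl
  rw [D.hsl, D.hslast] at h3
  rw [D.hsl] at h4
  rw [D.hsl]
  have hN : D.p D.l < d * n ^ 2 := by linarith
  have hdn : 0 < d * n := by nlinarith
  have hq1 : 0 < d * n * (n - a) := mul_pos hdn (by omega)
  have hq2 : 0 < d * n * a := mul_pos hdn ha
  have hdv : d * n ^ 2 ∣ D.p D.l - (d * n * (n - a) - 1) := by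
    obtain ⟨c, hc⟩ := h4
    refine ⟨(d * n * (n - a) - 1) * c - D.p D.l * (d * a * (n - a) - 1), ?_⟩
    linear_combination (d * n * (n - a) - 1) * hc
  have h0 : D.p D.l - (d * n * (n - a) - 1) = 0 := by
    apply Int.eq_zero_of_abs_lt_dvd hdv
    rw [abs_lt]
    constructor <;> nlinarith
  constructor <;> linarith
end

section
/- Let (d, n, a) be a class-T triple, with Hirzebruch–Jung data (l; b_1, …, b_l; (p_i); (q_i)) for the pair (dn², dna − 1). Then b_1 ≥ 3 or b_l ≥ 3. -/
/-- The first assertion of Lemma `lem:n=2` of the paper: for a class-T triple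
`(d, n, a)`, the Hirzebruch–Jung expansion of `dn²/(dna − 1)` satisfies
`b_1 ≥ 3` or `b_l ≥ 3`. -/
theorem hj_classT_not_all_two (d n a : ℤ) (hd : 0 < d) (ha : 0 < a)
    (han : a < n) (hcop : IsCoprime n a)
    (D : HJData (d * n ^ 2) (d * n * a - 1)) :
    3 ≤ D.b 1 ∨ 3 ≤ D.b D.l := by
  obtain ⟨l, b, p, s, hl, hb, hp0, hp1, hs0, hs1, hrecp, hrecs, hsdec, hsl, hslast⟩ := D
  show 3 ≤ b 1 ∨ 3 ≤ b l
  by_contra hcon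
  push Not at hcon
  obtain ⟨h1, h2⟩ := hcon
  have hb1 : b 1 = 2 := by have := hb 1 le_rfl hl; omega
  have hbl : b l = 2 := by have := hb l hl le_rfl; omega
  have hn : 0 < n := by omega
  have hdn : 0 < d * n := mul_pos hd hn
  have key : ∀ i, i ≤ l → 0 ≤ p i ∧ p i < p (i + 1) ∧
      p (i + 1) * s i - p i * s (i + 1) = d * n ^ 2 ∧
      (d * n ^ 2 ∣ p i * (d * n * a - 1) - s i) ∧
      (d * n ^ 2 ∣ p (i + 1) * (d * n * a - 1) - s (i + 1)) := by
    intro i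
    induction i with
    | zero =>
      intro _
      simp [hp0, hp1, hs0, hs1]
    | succ k ih =>
      intro hk
      obtain ⟨i1, i2, i3, i4, i5⟩ := ih (by omega)
      have e1 := hrecp (k + 1) (by omega) hk
      have e2 := hrecs (k + 1) (by omega) hk
      have e3 := hb (k + 1) (by omega) hk
      simp only [Nat.add_sub_cancel] at e1 e2
      refine ⟨by omega, ?_, ?_, i5, ?_⟩
      · rw [e1]; nlinarith
      · rw [e1, e2, ← i3]; ring
      · rw [e1, e2]
        obtain ⟨x, hx⟩ := i4
        obtain ⟨y, hy⟩ := i5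
        exact ⟨b (k + 1) * y - x, by linear_combination b (k + 1) * hy - hx⟩
  -- the first entry
  have f1 : 0 ≤ s 2 := by
    rcases Nat.lt_or_ge 1 l with h | h
    · have hpos : ∀ j, j ≤ l → 0 < s (l - j) := by
        intro j
        induction j with
        | zero => intro _; simp [hsl]
        | succ k ih =>
          intro hk
          have h3 := ih (by omega)
          have h4 := hsdec (l - (k + 1)) (by omega)
          rw [show l - (k + 1) + 1 = l - k by omega] at h4
          omega
      have := hpos (l - 2) (by omega)
      rw [show l - (l - 2) = 2 by omega] at this
      exact this.le
    · have : l = 1 := by omega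
      subst this
      exact hslast.ge
  have e := hrecs 1 le_rfl hl
  simp only [Nat.sub_self, hs0, hs1, hb1, Nat.reduceAdd] at e
  have g1 : n < 2 * a := by
    by_contra hc
    nlinarith [mul_nonneg hdn.le (by omega : 0 ≤ n - 2 * a)]
  obtain ⟨k1, k2, k3, k4, -⟩ := key l le_rfl
  rw [hsl, hslast] at k3
  rw [hsl] at k4
  have hpl : p l = d * n * (n - a) - 1 := by
    obtain ⟨c, hc⟩ := k4
    have hdvd : d * n ^ 2 ∣ p l - (d * n * (n - a) - 1) := by
      refine ⟨c * (d * n * (n - a) - 1) - p l * (d * a * (n - a) - 1), ?_⟩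
      linear_combination (d * n * (n - a) - 1) * hc
    have b1 : 0 < d * n * (n - a) := mul_pos hdn (by omega)
    have b2 : 0 < d * n * a := mul_pos hdn ha
    have := Int.eq_zero_of_abs_lt_dvd hdvd (by rw [abs_lt]; constructor <;> nlinarith)
    linarith
  obtain ⟨m, rfl⟩ : ∃ m, l = m + 1 := ⟨l - 1, by omega⟩
  have e' := hrecp (m + 1) hl le_rfl
  simp only [Nat.add_sub_cancel, hbl] at e'
  have := (key m (by omega)).1
  nlinarith [mul_pos hdn (by omega : 0 < 2 * a - n)]
end

section
/- Let (d, n, a) be a class-T triple, with Hirzebruch–Jung data (l; b_1, …, b_l; (p_i); (q_i)) for the pair (dn², dna − 1). If b_1 ≥ 3 and b_l ≥ 3, then n = 2, a = 1, and d = l; moreover, if l = 1 then b_1 = 4, and if l ≥ 2 then b_1 = b_l = 3 and b_i = 2 for all 1 < i < l; and for all 1 ≤ i ≤ l one has p_i = 2i − 1, q_i = 2(l − i) + 1, and p_i + q_i = 2l (so r_i := (p_i + q_i)/(dn) = 1). -/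
lemma hj_s_pos {N q : ℤ} (D : HJData N q) : ∀ i, i ≤ D.l → 1 ≤ D.s i := by
  intro i hi
  induction hi using Nat.decreasingInduction with
  | self => rw [D.hsl]
  | of_succ k hk ih =>
    have := D.hsdec k (by omega)
    omega

lemma hj_p_inc {N q : ℤ} (D : HJData N q) : ∀ i, i ≤ D.l → 0 ≤ D.p i ∧ D.p i < D.p (i + 1) := by
  intro i
  induction i with
  | zero => intro _; simp [D.hp0, D.hp1]
  | succ k ih =>
    intro hk
    obtain ⟨h0, h1⟩ := ih (by omega)
    have hb := D.hb (k + 1) (by omega) hk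
    have hr := D.hrecp (k + 1) (by omega) hk
    simp only [Nat.add_sub_cancel] at hr
    refine ⟨by omega, ?_⟩
    rw [hr]
    nlinarith

lemma hj_wr {N q : ℤ} (D : HJData N q) : ∀ i, i ≤ D.l →
    D.p (i + 1) * D.s i - D.p i * D.s (i + 1) = N := by
  intro i
  induction i with
  | zero => intro _; simp [D.hp0, D.hp1, D.hs0]
  | succ k ih =>
    intro hk
    have h := ih (by omega)
    have hr := D.hrecp (k + 1) (by omega) hk
    have hs := D.hrecs (k + 1) (by omega) hk
    simp only [Nat.add_sub_cancel] at hr hs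
    rw [hr, hs]
    linarith

lemma hj_mod {N q : ℤ} (D : HJData N q) : ∀ i, i ≤ D.l →
    N ∣ q * D.p i - D.s i ∧ N ∣ q * D.p (i + 1) - D.s (i + 1) := by
  intro i
  induction i with
  | zero => intro _; simp [D.hp0, D.hp1, D.hs0, D.hs1]
  | succ k ih =>
    intro hk
    obtain ⟨h0, h1⟩ := ih (by omega)
    refine ⟨h1, ?_⟩
    have hr := D.hrecp (k + 1) (by omega) hk
    have hs := D.hrecs (k + 1) (by omega) hk
    simp only [Nat.add_sub_cancel] at hr hs
    rw [hr, hs]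
    have := dvd_sub (h1.mul_left (D.b (k + 1))) h0
    have e : q * (D.b (k + 1) * D.p (k + 1) - D.p k) - (D.b (k + 1) * D.s (k + 1) - D.s k)
        = D.b (k + 1) * (q * D.p (k + 1) - D.s (k + 1)) - (q * D.p k - D.s k) := by ring
    rw [e]
    exact this

lemma hj_na (d n a : ℤ) (hd : 0 < d) (ha : 0 < a)
    (han : a < n) (hcop : IsCoprime n a)
    (D : HJData (d * n ^ 2) (d * n * a - 1))
    (h1 : 3 ≤ D.b 1) (h2 : 3 ≤ D.b D.l) : n = 2 ∧ a = 1 := by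
  have hl := D.hl
  have hdn : 2 ≤ d * n := by nlinarith
  have A : 2 * a ≤ n := by
    have hr := D.hrecs 1 le_rfl hl
    have hdec := D.hsdec 1 hl
    have hp := hj_s_pos D 1 hl
    simp only [Nat.sub_self, D.hs0] at hr
    have h3 : 2 * D.s 1 < d * n ^ 2 := by nlinarith
    rw [D.hs1] at h3
    by_contra hc
    have : d * n * (2 * a - n) ≥ d * n * 1 := by
      apply mul_le_mul_of_nonneg_left <;> omega
    nlinarith
  have B : n ≤ 2 * a := by
    obtain ⟨l, hl'⟩ : ∃ l, D.l = l + 1 := ⟨D.l - 1, by omega⟩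
    have hr := D.hrecp D.l hl le_rfl
    have hw := hj_wr D D.l le_rfl
    rw [D.hslast, D.hsl] at hw
    have hm := (hj_mod D D.l le_rfl).1
    rw [D.hsl] at hm
    have hi := hj_p_inc D l (by omega)
    have hi2 := hj_p_inc D D.l le_rfl
    rw [← hl'] at hi
    have e : D.l - 1 = l := by omega
    rw [e] at hr
    set P := D.p D.l
    have h3 : 2 * P < d * n ^ 2 := by nlinarith
    have hinv : d * n ^ 2 ∣ P - (d * n * (n - a) - 1) := by
      obtain ⟨c, hc⟩ := hm
      refine ⟨(d * n * (n - a) - 1) * c - P * (d * a * (n - a) - 1), ?_⟩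
      linear_combination (d * n * (n - a) - 1) * hc
    have hQ : 0 < d * n * (n - a) := by
      apply mul_pos <;> omega
    have hQ2 : 0 < d * n * a := by
      apply mul_pos <;> omega
    have hz : P - (d * n * (n - a) - 1) = 0 := by
      apply Int.eq_zero_of_abs_lt_dvd hinv
      rw [abs_lt]
      constructor <;> nlinarith
    by_contra hc
    have : d * n * (n - 2 * a) ≥ d * n * 1 := by
      apply mul_le_mul_of_nonneg_left <;> omega
    nlinarith
  have hn : n = 2 * a := le_antisymm B A
  have hu : IsUnit a := by
    apply hcop.isUnit_of_dvd' _ dvd_rfl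
    exact ⟨2, by omega⟩
  rcases Int.isUnit_iff.1 hu with h | h <;> omega

lemma hj_step (d : ℤ) (N q : ℤ) (D : HJData N q) (hN : N = 4 * d) (hq : q = 2 * d - 1)
    (h1 : 3 ≤ D.b 1) : ∀ i : ℕ, i + 1 ≤ D.l →
      D.p (i + 1) = 2 * (i : ℤ) + 1 ∧ D.s (i + 1) = 2 * (d - i) - 1 ∧
      (i + 1 < D.l → D.p (i + 2) = 2 * (i : ℤ) + 3 ∧ D.s (i + 2) = 2 * (d - i) - 3 ∧
        D.b (i + 1) = if i = 0 then 3 else 2) := by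
  intro i
  induction i with
  | zero =>
    intro hl
    refine ⟨by simp [D.hp1], by simp [D.hs1, hq], ?_⟩
    intro hl2
    have hr := D.hrecp 1 le_rfl hl
    have hs := D.hrecs 1 le_rfl hl
    have hdec := D.hsdec 1 hl
    have hp := hj_s_pos D 2 hl2
    simp only [Nat.sub_self, D.hs0, D.hs1, D.hp0, D.hp1, hN, hq] at hr hs hdec
    norm_num at hr hs hdec
    have hb : D.b 1 = 3 := by
      by_contra hc
      have : 4 ≤ D.b 1 := by omega
      have : d < 2 := by nlinarith
      have : d = 1 := by omega
      subst this
      omega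
    rw [hb] at hr hs
    simp [hb]
    omega
  | succ k ih =>
    intro hk
    obtain ⟨p1, s1, h⟩ := ih (by omega)
    obtain ⟨p2, s2, -⟩ := h (by omega)
    refine ⟨by rw [p2]; push_cast; ring, by rw [s2]; push_cast; ring, ?_⟩
    intro hl2
    have hr := D.hrecp (k + 2) (by omega) (by omega)
    have hs := D.hrecs (k + 2) (by omega) (by omega)
    have hdec := D.hsdec (k + 2) (by omega)
    have hp := hj_s_pos D (k + 3) (by omega)
    have hb2 := D.hb (k + 2) (by omega) (by omega)
    have e : k + 2 - 1 = k + 1 := rfl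
    rw [e, p1, p2] at hr
    rw [e, s1, s2] at hs
    have hp' := hj_s_pos D (k + 2) (by omega)
    simp only [show k + 2 + 1 = k + 3 from rfl] at hr hs hdec
    have hb : D.b (k + 2) = 2 := by
      by_contra hc
      have hc3 : 3 ≤ D.b (k + 2) := by omega
      rw [s2] at hp' hdec
      have : 2 * (d - k) - 3 < 2 := by nlinarith
      have h1' : 2 * (d - k) - 3 = 1 := by omega
      rw [h1'] at hs
      omega
    rw [hb] at hr hs
    refine ⟨?_, ?_, ?_⟩
    · show D.p (k + 3) = _
      push_cast; omega
    · show D.s (k + 3) = _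
      push_cast; omega
    · show D.b (k + 2) = _
      simp [hb]

/-- The second assertion of Lemma `lem:n=2` of the paper: if both end entries
of the Hirzebruch–Jung expansion of `dn²/(dna − 1)` are `≥ 3`, then
`(d, n, a) = (l, 2, 1)`; moreover the expansion is `(4)` if `l = 1` and
`(3, 2, …, 2, 3)` if `l ≥ 2`, and `p_i = 2i − 1`, `q_i = 2(l − i) + 1`,
`p_i + q_i = 2l` for all `1 ≤ i ≤ l`. -/
theorem hj_classT_both_ends_ge_three (d n a : ℤ) (hd : 0 < d) (ha : 0 < a)
    (han : a < n) (hcop : IsCoprime n a)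
    (D : HJData (d * n ^ 2) (d * n * a - 1))
    (h1 : 3 ≤ D.b 1) (h2 : 3 ≤ D.b D.l) :
    n = 2 ∧ a = 1 ∧ d = (D.l : ℤ) ∧
    (D.l = 1 → D.b 1 = 4) ∧
    (2 ≤ D.l → D.b 1 = 3 ∧ D.b D.l = 3 ∧
      ∀ i, 1 < i → i < D.l → D.b i = 2) ∧
    ∀ i, 1 ≤ i → i ≤ D.l →
      D.p i = 2 * (i : ℤ) - 1 ∧ D.s i = 2 * ((D.l : ℤ) - (i : ℤ)) + 1 ∧
      D.p i + D.s i = 2 * (D.l : ℤ) := by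
  obtain ⟨rfl, rfl⟩ := hj_na d n a hd ha han hcop D h1 h2
  have H := hj_step d _ _ D (by ring) (by ring) h1
  have hl := D.hl
  obtain ⟨m, hm⟩ : ∃ m, D.l = m + 1 := ⟨D.l - 1, by omega⟩
  have hdl : d = (D.l : ℤ) := by
    have h := (H m (by omega)).2.1
    rw [← hm, D.hsl] at h
    rw [hm]; push_cast; omega
  refine ⟨rfl, rfl, hdl, ?_, ?_, ?_⟩
  · intro e
    have hs := D.hrecs 1 le_rfl hl
    have h3 := D.hslast
    have h4 := D.hsl
    have h5 := D.hs0
    rw [e] at h3 h4 hdl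
    simp only [Nat.sub_self, h3, h4, h5] at hs
    push_cast at hdl
    linarith
  · intro hl2
    refine ⟨?_, ?_, ?_⟩
    · simpa using ((H 0 (by omega)).2.2 (by omega)).2.2
    · have hs := D.hrecs D.l hl le_rfl
      obtain ⟨k, hk⟩ : ∃ k, D.l = k + 2 := ⟨D.l - 2, by omega⟩
      have h := (H k (by omega)).2.1
      have e : D.l - 1 = k + 1 := by omega
      rw [D.hslast, D.hsl, e, h] at hs
      omega
    · intro i hi hil
      obtain ⟨k, rfl⟩ : ∃ k, i = k + 1 := ⟨i - 1, by omega⟩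
      have h := ((H k (by omega)).2.2 hil).2.2
      rwa [if_neg (by omega)] at h
  · intro i hi hil
    obtain ⟨k, rfl⟩ : ∃ k, i = k + 1 := ⟨i - 1, by omega⟩
    obtain ⟨hp, hs, -⟩ := H k hil
    rw [hp, hs, ← hdl]
    push_cast
    refine ⟨by ring, by ring, by ring⟩
end

section
/- Let (d, n, a) be a class-T triple and suppose dn²/(dna − 1) = [b_1, …, b_l] with all b_i ≥ 2. Then (d, n + a, a) is a class-T triple, and d(n + a)²/(d(n + a)a − 1) = [b_1 + 1, b_2, …, b_l, 2]; in particular, the Hirzebruch–Jung expansion of d(n + a)²/(d(n + a)a − 1) has length l + 1, and its entries satisfy (b_1 + 1) + b_2 + ⋯ + b_l + 2 − (2(l + 1) + 1) = (b_1 + ⋯ + b_l − (2l + 1)) + 1, i.e., δ(d, n + a, a) = δ(d, n, a) + 1. -/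
/-- The Hirzebruch–Jung (negative-regular) continued fraction
`[c_1, …, c_m] = c_1 − 1/(c_2 − 1/(⋯ − 1/c_m))`, defined recursively by
`[c_m] = c_m` and `[c_i, …, c_m] = c_i − 1/[c_{i+1}, …, c_m]`
(with junk value `1` on the empty list). -/
def hjCF : List ℤ → ℚ
  | [] => 1
  | [c] => (c : ℚ)
  | c :: c' :: cs => (c : ℚ) - 1 / hjCF (c' :: cs)

theorem hj_aux (bs : List ℤ) : ∀ b : ℤ, (∀ c ∈ b :: bs, 2 ≤ c) →
    ∃ p q p' q' : ℤ, p' * q - p * q' = 1 ∧ 0 < q ∧ q < p ∧ 0 ≤ q' ∧ q' < q ∧ 0 < p' ∧ p' < p ∧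
      q' ≤ p' ∧ p' - q' ≤ p - q ∧ hjCF (b :: bs) = (p : ℚ) / q ∧
      hjCF (b :: (bs ++ [2])) = ((2 * p - p' : ℤ) : ℚ) / ((2 * q - q' : ℤ) : ℚ) := by
  induction bs with
  | nil =>
    intro b hb
    have h2 : 2 ≤ b := hb b (by simp)
    refine ⟨b, 1, 1, 0, by ring, by omega, by omega, by omega, by omega, by omega, by omega,
      by omega, by omega, by simp [hjCF], ?_⟩
    simp [hjCF]
    ring
  | cons c cs ih =>
    intro b hb
    have h2 : 2 ≤ b := hb b (by simp)
    obtain ⟨p, q, p', q', h, h3, h4, h5, h6, h7, h8, h9, h10, e1, e2⟩ :=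
      ih c (fun x hx => hb x (List.mem_cons_of_mem _ hx))
    refine ⟨b * p - q, p, b * p' - q', p', by linarith, by omega, by nlinarith, by omega, by omega,
      by nlinarith, by nlinarith, by nlinarith, by nlinarith, ?_, ?_⟩
    · have hp : (p : ℚ) ≠ 0 := by exact_mod_cast (by omega : p ≠ 0)
      simp only [hjCF, e1]
      push_cast
      field_simp
    · have hp : ((2 * p - p' : ℤ) : ℚ) ≠ 0 := by exact_mod_cast (by omega : 2 * p - p' ≠ 0)
      simp only [List.cons_append, hjCF, e2]
      rw [one_div_div, eq_div_iff hp, sub_mul, div_mul_cancel₀ _ hp]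
      push_cast
      ring

theorem hj_succ (b c : ℤ) (cs : List ℤ) : hjCF ((b + 1) :: c :: cs) = hjCF (b :: c :: cs) + 1 := by
  simp only [hjCF]
  push_cast
  ring

/-- The `t_R`-part of Lemma `lem:going-up` of the paper: if `(d, n, a)` is a
class-T triple with `dn²/(dna − 1) = [b_1, …, b_l]`, then `(d, n + a, a)` is
a class-T triple and `d(n+a)²/(d(n+a)a − 1) = [b_1 + 1, b_2, …, b_l, 2]`;
in particular the new expansion has length `l + 1` and
`δ(d, n + a, a) = δ(d, n, a) + 1`. -/
theorem hj_classT_tR (d n a : ℤ) (hd : 0 < d) (ha : 0 < a) (han : a < n)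
    (hcop : IsCoprime n a) (b₁ : ℤ) (bs : List ℤ)
    (hb : ∀ c ∈ b₁ :: bs, 2 ≤ c)
    (hcf : ((d * n ^ 2 : ℤ) : ℚ) / ((d * n * a - 1 : ℤ) : ℚ)
      = hjCF (b₁ :: bs)) :
    (0 < a ∧ a < n + a ∧ IsCoprime (n + a) a) ∧
    ((d * (n + a) ^ 2 : ℤ) : ℚ) / ((d * (n + a) * a - 1 : ℤ) : ℚ)
      = hjCF ((b₁ + 1) :: (bs ++ [2])) ∧
    ((b₁ + 1) :: (bs ++ [2])).length = (b₁ :: bs).length + 1 ∧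
    ((b₁ + 1) :: (bs ++ [2])).sum
        - (2 * ((((b₁ + 1) :: (bs ++ [2])).length : ℤ)) + 1)
      = (b₁ :: bs).sum - (2 * (((b₁ :: bs).length : ℤ)) + 1) + 1 := by
  refine ⟨⟨ha, by omega, ?_⟩, ?_, by simp, ?_⟩
  · simpa using hcop.add_mul_left_left 1
  · obtain ⟨p, q, p', q', h, h3, h4, h5, h6, h7, h8, h9, h10, e1, e2⟩ := hj_aux bs b₁ hb
    have hs : hjCF ((b₁ + 1) :: (bs ++ [2])) = hjCF (b₁ :: (bs ++ [2])) + 1 := by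
      cases bs with
      | nil => exact hj_succ _ _ _
      | cons c cs => exact hj_succ _ _ _
    have hdn : 0 < d * n := by nlinarith
    have hna : 2 ≤ d * n * a := by nlinarith
    have hQ : 0 < d * n * a - 1 := by omega
    have hc1 : IsCoprime (d * n ^ 2) (d * n * a - 1) :=
      ⟨-(d * a * (n - a) - 1), d * n * (n - a) - 1, by ring⟩
    have hc2 : IsCoprime p q := ⟨-q', p', by linarith⟩
    rw [e1] at hcf
    have hpq : d * n ^ 2 = p ∧ d * n * a - 1 = q :=
      Rat.div_int_inj hQ h3 (Int.isCoprime_iff_nat_coprime.1 hc1)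
        (Int.isCoprime_iff_nat_coprime.1 hc2) hcf
    obtain ⟨hp, hq⟩ := hpq
    have hp0 : 0 < p := by omega
    have hdvd : p ∣ p' - (d * n * (n - a) - 1) := by
      refine hc2.dvd_of_dvd_mul_right ⟨q' - (d * a * (n - a) - 1), ?_⟩
      have : (d * n * (n - a) - 1) * q - p * (d * a * (n - a) - 1) = 1 := by
        rw [← hp, ← hq]; ring
      linarith
    have hu : 0 < d * n * (n - a) := by nlinarith
    have hpe : p = d * n * (n - a) + d * n * a := by rw [← hp]; ring
    have hp' : p' = d * n * (n - a) - 1 := by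
      have := Int.eq_zero_of_abs_lt_dvd hdvd (by rw [abs_lt]; constructor <;> omega)
      omega
    have hq' : q' = d * a * (n - a) - 1 := by
      apply mul_left_cancel₀ hp0.ne'
      have : (d * n * (n - a) - 1) * q - p * (d * a * (n - a) - 1) = 1 := by
        rw [← hp, ← hq]; ring
      rw [hp'] at h
      linarith
    have hden : 2 * q - q' = d * (n + a) * a - 1 := by rw [hq', ← hq]; ring
    have hnum : 2 * p - p' = d * (n + a) ^ 2 - (d * (n + a) * a - 1) := by
      rw [hp', ← hp]; ring
    have hne : ((d * (n + a) * a - 1 : ℤ) : ℚ) ≠ 0 := by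
      rw [← hden]; exact_mod_cast (by omega : 2 * q - q' ≠ 0)
    rw [hs, e2, hden, hnum, Int.cast_sub (d * (n + a) ^ 2), sub_div, div_self hne]
    ring
  · simp
    ring
end

section
/- Let (d, n, a) be a class-T triple, with Hirzebruch–Jung data (l; b_1, …, b_l; (p_i); (q_i)) for the pair (dn², dna − 1), and let (l'; b'_1, …, b'_{l'}; (p'_i); (q'_i)) be the Hirzebruch–Jung data for the pair (d(n + a)², d(n + a)a − 1) associated with the class-T triple (d, n + a, a). Then l' = l + 1, and for all 1 ≤ i ≤ l + 1: dn²·p'_i = (dn(n + a) − 1)·p_i − q_i and dn²·q'_i = p_i + (dn(n + a) + 1)·q_i; consequently n·(p'_i + q'_i) = (n + a)·(p_i + q_i), i.e., (p'_i + q'_i)/(d(n + a)) = (p_i + q_i)/(dn) for all 1 ≤ i ≤ l + 1. -/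
theorem HJ_s_pos {n q : ℤ} (D : HJData n q) (k : ℕ) (hk : k ≤ D.l + 1) :
    (k : ℤ) ≤ D.s (D.l + 1 - k) := by
  induction k with
  | zero => simp [D.hslast]
  | succ k ih =>
    have h1 := ih (by omega)
    have h2 := D.hsdec (D.l + 1 - (k + 1)) (by omega)
    rw [show D.l + 1 - (k + 1) + 1 = D.l + 1 - k by omega] at h2
    push_cast
    rw [show D.l + 1 - (k + 1) = D.l - k by omega] at h2
    linarith [Int.add_one_le_iff.mpr h2]

theorem HJ_s_ge {n q : ℤ} (D : HJData n q) (i : ℕ) (hi : i ≤ D.l + 1) :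
    (D.l : ℤ) + 1 - i ≤ D.s i := by
  have h := HJ_s_pos D (D.l + 1 - i) (by omega)
  rw [show D.l + 1 - (D.l + 1 - i) = i by omega] at h
  omega

theorem HJ_p_inc {n q : ℤ} (D : HJData n q) (i : ℕ) (hi : i ≤ D.l) :
    0 ≤ D.p i ∧ D.p i < D.p (i + 1) := by
  induction i with
  | zero => simp [D.hp0, D.hp1]
  | succ k ih =>
    obtain ⟨h1, h2⟩ := ih (by omega)
    have h3 := D.hrecp (k + 1) (by omega) hi
    have h4 := D.hb (k + 1) (by omega) hi
    rw [Nat.add_sub_cancel] at h3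
    refine ⟨by omega, ?_⟩
    nlinarith

theorem HJ_det {n q : ℤ} (D : HJData n q) (i : ℕ) (hi : i ≤ D.l) :
    D.p (i + 1) * D.s i - D.p i * D.s (i + 1) = n := by
  induction i with
  | zero => simp [D.hp0, D.hp1, D.hs0]
  | succ k ih =>
    have h1 := ih (by omega)
    have h3 := D.hrecp (k + 1) (by omega) hi
    have h4 := D.hrecs (k + 1) (by omega) hi
    rw [Nat.add_sub_cancel] at h3 h4
    rw [h3, h4]
    linear_combination h1

theorem HJ_p_le {n q : ℤ} (D : HJData n q) (i : ℕ) (hi : i ≤ D.l) :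
    D.p (i + 1) ≤ n := by
  have h1 := HJ_det D i hi
  obtain ⟨h2, h3⟩ := HJ_p_inc D i hi
  have h4 := D.hsdec i hi
  have h5 := HJ_s_ge D (i + 1) (by omega)
  have h6 : 0 ≤ D.s (i + 1) := by push_cast at h5; omega
  nlinarith

theorem HJ_uniq {X u t β : ℤ} (hu : 0 ≤ u) (hu' : u < X) (ht : 0 ≤ t) (ht' : t < X)
    (h : u - t = β * X) : β = 0 := by
  have h1 : β < 1 := by by_contra hc; nlinarith
  have h2 : -1 < β := by by_contra hc; nlinarith
  omega

/-- The matrix identity (eq:p'iq'i) from the proof of Lemma `lem:going-up` of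
the paper, comparing the Hirzebruch–Jung data of `(dn², dna − 1)` and of
`(d(n+a)², d(n+a)a − 1)`: one has `l' = l + 1`, and for `1 ≤ i ≤ l + 1`,
`dn²·p'_i = (dn(n+a) − 1)·p_i − q_i`, `dn²·q'_i = p_i + (dn(n+a) + 1)·q_i`;
consequently `n·(p'_i + q'_i) = (n + a)·(p_i + q_i)`, i.e. the invariants
`r_i` are preserved. -/
theorem hj_classT_tR_data (d n a : ℤ) (hd : 0 < d) (ha : 0 < a) (han : a < n)
    (hcop : IsCoprime n a)
    (D : HJData (d * n ^ 2) (d * n * a - 1))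
    (D' : HJData (d * (n + a) ^ 2) (d * (n + a) * a - 1)) :
    D'.l = D.l + 1 ∧
    ∀ i, 1 ≤ i → i ≤ D.l + 1 →
      d * n ^ 2 * D'.p i = (d * n * (n + a) - 1) * D.p i - D.s i ∧
      d * n ^ 2 * D'.s i = D.p i + (d * n * (n + a) + 1) * D.s i ∧
      n * (D'.p i + D'.s i) = (n + a) * (D.p i + D.s i) := by
  obtain ⟨N, hN⟩ : ∃ N, N = d * n ^ 2 := ⟨_, rfl⟩
  obtain ⟨M, hM⟩ : ∃ M, M = d * n * (n + a) + 1 := ⟨_, rfl⟩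
  have hn : 0 < n := by omega
  have hNpos : 0 < N := by rw [hN]; positivity
  have hMN : N < M := by
    have : 0 < d * n * a := by positivity
    rw [hN, hM]; nlinarith
  -- decrease of the candidate
  have hdec : ∀ i, i ≤ D.l → D.p (i+1) + M * D.s (i+1) < D.p i + M * D.s i := by
    intro i hi
    have h1 := HJ_p_le D i hi
    have h2 := (HJ_p_inc D i hi).1
    have h3 := D.hsdec i hi
    have h1' : D.p (i+1) ≤ N := h1.trans hN.ge
    nlinarith
  have hpos : ∀ i, i ≤ D.l → 0 < D.p (i+1) + M * D.s (i+1) := by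
    intro i hi
    have h2 := HJ_p_inc D i hi
    have h5 := HJ_s_ge D (i + 1) (by omega)
    have h6 : 0 ≤ D.s (i + 1) := by push_cast at h5; omega
    have : 0 ≤ M * D.s (i+1) := mul_nonneg (by omega) h6
    omega
  have hlen : ∀ i, i ≤ D'.l + 1 → 0 < N * D'.s i → i ≤ D'.l := by
    intro i hi h
    by_contra hc
    have : i = D'.l + 1 := by omega
    rw [this, D'.hslast] at h
    simp at h
  have hnext : ∀ i, i ≤ D'.l → 0 ≤ N * D'.s (i+1) ∧ N * D'.s (i+1) < N * D'.s i := by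
    intro i hi
    have h5 := HJ_s_ge D' (i + 1) (by omega)
    have h6 : 0 ≤ D'.s (i + 1) := by push_cast at h5; omega
    exact ⟨mul_nonneg hNpos.le h6, mul_lt_mul_of_pos_left (D'.hsdec i hi) hNpos⟩
  have hs1 : N * D'.s 1 = D.p 1 + M * D.s 1 := by
    rw [D'.hs1, D.hp1, D.hs1, hN, hM]; ring
  have hp1 : N * D'.p 1 = (M - 2) * D.p 1 - D.s 1 := by
    rw [D'.hp1, D.hp1, D.hs1, hN, hM]; ring
  have hl1 := D.hl
  have hl1' := D'.hl
  have key : ∀ i, i + 1 ≤ D.l →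
      (i + 1 ≤ D'.l ∧ N * D'.s (i+1) = D.p (i+1) + M * D.s (i+1) ∧
        N * D'.p (i+1) = (M - 2) * D.p (i+1) - D.s (i+1)) ∧
      (i + 2 ≤ D'.l ∧ N * D'.s (i+2) = D.p (i+2) + M * D.s (i+2) ∧
        N * D'.p (i+2) = (M - 2) * D.p (i+2) - D.s (i+2)) := by
    intro i
    induction i with
    | zero =>
      intro hi
      refine ⟨⟨hl1', hs1, hp1⟩, ?_⟩
      have r1 := D.hrecp 1 le_rfl hl1
      have r2 := D.hrecs 1 le_rfl hl1
      have r3 := D'.hrecp 1 le_rfl hl1'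
      have r4 := D'.hrecs 1 le_rfl hl1'
      simp only [Nat.reduceAdd, Nat.sub_self, D.hp0, D.hs0, D'.hp0, D'.hs0] at r1 r2 r3 r4
      have e1 := hnext 1 hl1'
      have e2 := hdec 1 hl1
      have e3 := hpos 1 hl1
      simp only [Nat.reduceAdd, zero_add] at e1 e2 e3 ⊢
      have hb : D'.b 1 - (D.b 1 + 1) = 0 := by
        apply HJ_uniq (X := N * D'.s 1) e1.1 e1.2 e3.le (by rw [hs1]; exact e2)
        have hq : N * D'.s 1 = N * (d * (n+a) * a - 1) := by rw [D'.hs1]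
        have hM2 : d * (n+a)^2 = M + (d * (n+a) * a - 1) := by rw [hM]; ring
        rw [r4, r1, r2]
        linear_combination D.b 1 * hs1 + hq - N * hM2 - M * hN
      have hb' : D'.b 1 = D.b 1 + 1 := by omega
      have t1 : N * D'.s 2 = D.p 2 + M * D.s 2 := by
        have hq : N * D'.s 1 = N * (d * (n+a) * a - 1) := by rw [D'.hs1]
        have hM2 : d * (n+a)^2 = M + (d * (n+a) * a - 1) := by rw [hM]; ring
        rw [r4, r1, r2, hb']
        linear_combination D.b 1 * hs1 + hq - N * hM2 - M * hN
      refine ⟨hlen 2 (by omega) (by rw [t1]; exact e3), t1, ?_⟩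
      rw [r3, r1, r2, hb']
      have := D'.hp1
      linear_combination D.b 1 * hp1 + N * this + hN
    | succ i ih =>
      intro hi
      obtain ⟨⟨a1, a2, a3⟩, ⟨c1, c2, c3⟩⟩ := ih (by omega)
      refine ⟨⟨c1, c2, c3⟩, ?_⟩
      have r1 := D.hrecp (i+2) (by omega) hi
      have r2 := D.hrecs (i+2) (by omega) hi
      have r3 := D'.hrecp (i+2) (by omega) c1
      have r4 := D'.hrecs (i+2) (by omega) c1
      rw [show i + 2 - 1 = i + 1 by omega] at r1 r2 r3 r4
      have e1 := hnext (i+2) c1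
      have e2 := hdec (i+2) hi
      have e3 := hpos (i+2) hi
      rw [show i + 1 + 2 = i + 2 + 1 by omega]
      have hb : D'.b (i+2) - D.b (i+2) = 0 := by
        apply HJ_uniq (X := N * D'.s (i+2)) e1.1 e1.2 e3.le (by rw [c2]; exact e2)
        rw [r4, r1, r2]
        linear_combination D.b (i+2) * c2 - a2
      have hb' : D'.b (i+2) = D.b (i+2) := by omega
      have t1 : N * D'.s (i+2+1) = D.p (i+2+1) + M * D.s (i+2+1) := by
        rw [r4, r1, r2, hb']
        linear_combination D.b (i+2) * c2 - a2
      refine ⟨hlen _ (by omega) (by rw [t1]; exact e3), t1, ?_⟩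
      rw [r3, r1, r2, hb']
      linear_combination D.b (i+2) * c3 - a3
  have key2 : ∀ i, 1 ≤ i → i ≤ D.l + 1 →
      i ≤ D'.l ∧ N * D'.s i = D.p i + M * D.s i ∧
        N * D'.p i = (M - 2) * D.p i - D.s i := by
    intro i h1 h2
    obtain ⟨j, rfl⟩ : ∃ j, i = j + 1 := ⟨i - 1, by omega⟩
    by_cases hj : j + 1 ≤ D.l
    · exact (key j hj).1
    · obtain ⟨k, rfl⟩ : ∃ k, j = k + 1 := ⟨j - 1, by omega⟩
      exact (key k (by omega)).2
  constructor
  · obtain ⟨h1, h2, -⟩ := key2 (D.l + 1) (by omega) le_rfl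
    have h3 := HJ_det D D.l le_rfl
    rw [D.hslast, D.hsl] at h3
    have h4 : D'.s (D.l + 1) = 1 := by
      rw [D.hslast] at h2
      apply mul_left_cancel₀ hNpos.ne'
      linarith
    have h5 := HJ_s_ge D' (D.l + 1) (by omega)
    rw [h4] at h5
    push_cast at h5
    omega
  · intro i h1 h2
    obtain ⟨-, k2, k3⟩ := key2 i h1 h2
    refine ⟨by linear_combination k3 - D'.p i * hN + D.p i * hM,
      by linear_combination k2 - D'.s i * hN + D.s i * hM, ?_⟩
    have hdn : d * n ≠ 0 := by positivity
    apply mul_left_cancel₀ hdn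
    rw [hN] at k2 k3
    rw [hM] at k2 k3
    linear_combination k2 + k3
end

section
/- Let (d, n, a) be a class-T triple, with Hirzebruch–Jung data (l; b_1, …, b_l; (p_i); (q_i)) for the pair (dn², dna − 1). Then Σ_{i=1}^{l} b_i = 3l + 2 − d; equivalently, δ(d, n, a) := Σ_{i=1}^{l} b_i − (2l + 1) = l − d + 1. -/
def hjF (L : List ℤ) (w : ℤ × ℤ) : ℤ × ℤ := L.foldr (fun b w => (b * w.1 - w.2, w.1)) w

theorem hjF_nil (w : ℤ × ℤ) : hjF [] w = w := rfl

theorem hjF_cons (b : ℤ) (L : List ℤ) (w : ℤ × ℤ) :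
    hjF (b :: L) w = (b * (hjF L w).1 - (hjF L w).2, (hjF L w).1) := rfl

theorem hjF_append (L L' : List ℤ) (w : ℤ × ℤ) : hjF (L ++ L') w = hjF L (hjF L' w) := by
  simp [hjF]

theorem hjF_lin (L : List ℤ) (u v : ℤ) :
    (hjF L (u, v)).1 = u * (hjF L (1, 0)).1 + v * (hjF L (0, 1)).1 ∧
    (hjF L (u, v)).2 = u * (hjF L (1, 0)).2 + v * (hjF L (0, 1)).2 := by
  induction L with
  | nil => simp [hjF_nil]
  | cons b L ih =>
    simp only [hjF_cons]
    refine ⟨?_, ih.1⟩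
    rw [ih.1, ih.2]; ring

theorem hjF_bd (L : List ℤ) (h : ∀ b ∈ L, 2 ≤ b) :
    0 ≤ (hjF L (1, 0)).2 ∧ (hjF L (1, 0)).2 < (hjF L (1, 0)).1 := by
  induction L with
  | nil => simp [hjF_nil]
  | cons b L ih =>
    have h1 := ih (fun x hx => h x (List.mem_cons_of_mem _ hx))
    have h2 := h b List.mem_cons_self
    simp only [hjF_cons]
    constructor
    · omega
    · nlinarith

/-- matrix invariant -/
def hjInv (L : List ℤ) (x y z w : ℤ) : Prop :=
  (hjF L (1, 0)).1 = x ∧ (hjF L (1, 0)).2 = y ∧ (hjF L (0, 1)).1 = z ∧ (hjF L (0, 1)).2 = w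

def hjT (L : List ℤ) (d n a : ℤ) : Prop :=
  hjInv L (d * n ^ 2) (d * n * a - 1) (-(d * n * (n - a) - 1)) (-(d * a * (n - a) - 1)) ∧
  (∀ b ∈ L, 2 ≤ b) ∧ L ≠ [] ∧ L.sum = 3 * (L.length : ℤ) + 2 - d

theorem hj_base (k : ℕ) : ∃ c L, 3 ≤ c ∧ hjT (c :: L) ((k : ℤ) + 1) 2 1 := by
  induction k with
  | zero => exact ⟨4, [], by norm_num, by simp [hjT, hjInv, hjF]⟩
  | succ k ih =>
    obtain ⟨c, L, hc, ⟨h1, h2, h3, h4⟩, h5, -, h6⟩ := ih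
    refine ⟨3, (c - 1) :: L, le_rfl, ⟨?_, ?_, ?_, ?_⟩, ?_, by simp, ?_⟩
    · simp only [hjF_cons] at *; push_cast; linarith
    · simp only [hjF_cons] at *; push_cast; linarith
    · simp only [hjF_cons] at *; push_cast; linarith
    · simp only [hjF_cons] at *; push_cast; linarith
    · simp only [List.mem_cons, forall_eq_or_imp] at *
      exact ⟨by omega, by omega, h5.2⟩
    · simp only [List.sum_cons, List.length_cons] at *; push_cast at *; linarith

theorem hj_opA (L : List ℤ) (d n a : ℤ) (h : hjT L d n a) : ∃ L', hjT L' d (2 * n - a) n := by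
  obtain ⟨⟨h1, h2, h3, h4⟩, h5, h0, h6⟩ := h
  rcases List.eq_nil_or_concat L with rfl | ⟨L, b, rfl⟩
  · exact absurd rfl h0
  rw [List.concat_eq_append] at *
  simp only [hjF_append, hjF_cons, hjF_nil] at h1 h2 h3 h4
  rw [(hjF_lin L _ _).1] at h1 h3
  rw [(hjF_lin L _ _).2] at h2 h4
  refine ⟨2 :: (L ++ [b + 1]), ⟨?_, ?_, ?_, ?_⟩, ?_, by simp, ?_⟩
  · simp only [hjF_append, hjF_cons, hjF_nil]
    rw [(hjF_lin L _ _).1, (hjF_lin L _ _).2]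
    linear_combination 2 * h1 - h2 - 2 * h3 + h4
  · simp only [hjF_append, hjF_cons, hjF_nil]
    rw [(hjF_lin L _ _).1]
    linear_combination h1 - h3
  · simp only [hjF_append, hjF_cons, hjF_nil]
    rw [(hjF_lin L _ _).1, (hjF_lin L _ _).2]
    linear_combination 2 * h3 - h4
  · simp only [hjF_append, hjF_cons, hjF_nil]
    rw [(hjF_lin L _ _).1]
    linear_combination h3
  · intro x hx
    simp only [List.mem_cons, List.mem_append, List.not_mem_nil, or_false] at hx h5
    rcases hx with rfl | hx | rfl
    · exact le_rfl
    · exact h5 x (Or.inl hx)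
    · have := h5 b (Or.inr rfl)
      omega
  · simp only [List.sum_cons, List.length_cons, List.sum_append, List.length_append, List.sum_nil,
      List.length_nil] at *
    push_cast at *; linarith

theorem hj_opB (L : List ℤ) (d n a : ℤ) (h : hjT L d n a) : ∃ L', hjT L' d (n + a) a := by
  obtain ⟨⟨h1, h2, h3, h4⟩, h5, h0, h6⟩ := h
  rcases L with _ | ⟨b, L⟩
  · exact absurd rfl h0
  simp only [hjF_cons] at h1 h2 h3 h4
  refine ⟨(b + 1) :: (L ++ [2]), ⟨?_, ?_, ?_, ?_⟩, ?_, by simp, ?_⟩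
  · simp only [hjF_append, hjF_cons, hjF_nil]
    rw [(hjF_lin L _ _).1, (hjF_lin L _ _).2]
    linear_combination 2 * h1 + 2 * h2 + h3 + h4
  · simp only [hjF_append, hjF_cons, hjF_nil]
    rw [(hjF_lin L _ _).1]
    linear_combination 2 * h2 + h4
  · simp only [hjF_append, hjF_cons, hjF_nil]
    rw [(hjF_lin L _ _).1, (hjF_lin L _ _).2]
    linear_combination -h1 - h2
  · simp only [hjF_append, hjF_cons, hjF_nil]
    rw [(hjF_lin L _ _).1]
    linear_combination -h2
  · intro x hx
    simp only [List.mem_cons, List.mem_append, List.not_mem_nil, or_false] at hx h5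
    rcases hx with rfl | hx | rfl
    · have := h5 b (Or.inl rfl)
      omega
    · exact h5 x (Or.inr hx)
    · exact le_rfl
  · simp only [List.sum_cons, List.length_cons, List.sum_append, List.length_append, List.sum_nil,
      List.length_nil] at *
    push_cast at *; linarith

theorem hj_exists (d : ℤ) (hd : 0 < d) (m : ℕ) : ∀ n a : ℤ, n ≤ m → 0 < a → a < n →
    IsCoprime n a → ∃ L, hjT L d n a := by
  induction m with
  | zero => intro n a h1 h2 h3; push_cast at h1; omega
  | succ m ih =>
    intro n a h1 h2 h3 hc
    push_cast at h1
    rcases lt_trichotomy (2 * a) n with h | h | h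
    · obtain ⟨L, hL⟩ := ih (n - a) a (by omega) h2 (by omega) (by
        obtain ⟨u, v, e⟩ := hc
        exact ⟨u, v + u, by linear_combination e⟩)
      have := hj_opB L d _ _ hL
      rwa [sub_add_cancel] at this
    · obtain ⟨u, v, e⟩ := hc
      have ha : a = 1 := by
        have : a ∣ 1 := ⟨2 * u + v, by rw [← e, ← h]; ring⟩
        exact Int.eq_one_of_dvd_one h2.le this
      subst ha
      obtain ⟨c, L, -, hL⟩ := hj_base (d - 1).toNat
      have e2 : (((d - 1).toNat : ℕ) : ℤ) + 1 = d := by omega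
      rw [e2] at hL
      rw [← h]
      exact ⟨_, hL⟩
    · obtain ⟨L, hL⟩ := ih a (2 * a - n) (by omega) (by omega) (by omega) (by
        obtain ⟨u, v, e⟩ := hc
        exact ⟨v + 2 * u, -u, by linear_combination e⟩)
      have := hj_opA L d _ _ hL
      rwa [sub_sub_cancel] at this

theorem hj_pos {N q : ℤ} (D : HJData N q) (j : ℕ) : ∀ i, i + j = D.l → 1 ≤ D.s i := by
  induction j with
  | zero => intro i hi; have : i = D.l := hi
            rw [this, D.hsl]
  | succ j ih =>
    intro i hi
    have := ih (i + 1) (by omega)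
    have := D.hsdec i (by omega)
    omega

theorem hj_unique {N q : ℤ} (D : HJData N q) (L : List ℤ) : ∀ k, k ≤ D.l → (∀ b ∈ L, 2 ≤ b) →
    (hjF L (1, 0)).1 = D.s k → (hjF L (1, 0)).2 = D.s (k + 1) →
    L.length + k = D.l ∧ L.sum = ∑ i ∈ Finset.Ico (k + 1) (D.l + 1), D.b i := by
  induction L with
  | nil =>
    intro k hk _ _ h2
    simp only [hjF_nil] at h2
    have : k = D.l := by
      by_contra hne
      have := hj_pos D (D.l - (k + 1)) (k + 1) (by omega)
      omega
    subst this
    simp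
  | cons c L ih =>
    intro k hk hL h1 h2
    have hL' : ∀ b ∈ L, 2 ≤ b := fun x hx => hL x (List.mem_cons_of_mem _ hx)
    have hb := hjF_bd L hL'
    simp only [hjF_cons] at h1 h2
    have hkl : k < D.l := by
      by_contra hne
      have : k = D.l := by omega
      subst this
      have := D.hslast
      omega
    have hr := D.hrecs (k + 1) (by omega) (by omega)
    rw [Nat.add_sub_cancel] at hr
    have hd := D.hsdec (k + 1) (by omega)
    have hn : 0 ≤ D.s (k + 1 + 1) := by
      rcases Nat.lt_or_ge (k + 1) D.l with h | h
      · have := hj_pos D (D.l - (k + 1 + 1)) (k + 1 + 1) (by omega)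
        omega
      · have : k + 1 = D.l := by omega
        rw [this, D.hslast]
    rw [← h1, ← h2] at hr
    rw [← h2] at hd
    generalize (hjF L (1, 0)).1 = x at *
    generalize hy : (hjF L (1, 0)).2 = y at *
    have hbc : D.b (k + 1) = c := by
      have e : (D.b (k + 1) - c) * x = D.s (k + 1 + 1) - y := by linarith
      rcases lt_trichotomy (D.b (k + 1)) c with h | h | h
      · nlinarith
      · exact h
      · nlinarith
    have hyy : y = D.s (k + 1 + 1) := by rw [hr, hbc]; ring
    obtain ⟨e1, e2⟩ := ih (k + 1) (by omega) hL' h2 hyy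
    refine ⟨by simp only [List.length_cons]; omega, ?_⟩
    rw [List.sum_cons, e2, Finset.sum_eq_sum_Ico_succ_bot (by omega : k + 1 < D.l + 1), hbc]

/-- The final assertion of Corollary `corsub:going-up` of the paper: for a
class-T triple `(d, n, a)` with Hirzebruch–Jung data for `(dn², dna − 1)`,
one has `Σ_{i=1}^{l} b_i = 3l + 2 − d`; equivalently
`δ(d, n, a) = Σ b_i − (2l + 1) = l − d + 1`. -/
theorem hj_classT_sum_b (d n a : ℤ) (hd : 0 < d) (ha : 0 < a) (han : a < n)
    (hcop : IsCoprime n a) (D : HJData (d * n ^ 2) (d * n * a - 1)) :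
    (∑ i ∈ Finset.Icc 1 D.l, D.b i) = 3 * (D.l : ℤ) + 2 - d ∧
    (∑ i ∈ Finset.Icc 1 D.l, D.b i) - (2 * (D.l : ℤ) + 1)
      = (D.l : ℤ) - d + 1 := by
  have key : (∑ i ∈ Finset.Icc 1 D.l, D.b i) = 3 * (D.l : ℤ) + 2 - d := by
    obtain ⟨L, ⟨h1, h2, -, -⟩, h5, -, h6⟩ := hj_exists d hd n.toNat n a (by omega) ha han hcop
    obtain ⟨e1, e2⟩ := hj_unique D L 0 (by omega) h5 (by rw [h1, D.hs0]) (by rw [h2, D.hs1])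
    have e3 : Finset.Icc 1 D.l = Finset.Ico (0 + 1) (D.l + 1) := by
      ext i; simp only [Finset.mem_Icc, Finset.mem_Ico]; omega
    rw [e3, ← e2, h6, ← e1]
    simp
  exact ⟨key, by rw [key]; ring⟩
end

section
/- Define maps on class-T triples by t_L(d, n, a) = (d, 2n − a, n) and t_R(d, n, a) = (d, n + a, a); both maps send class-T triples to class-T triples. Every class-T triple (d, n, a) is obtained from (d, 2, 1) by applying a composition of exactly l − d maps, each equal to t_L or t_R, where l is the length of the Hirzebruch–Jung continued fraction expansion dn²/(dna − 1) = [b_1, …, b_l]. In particular, the set of all class-T triples is the smallest set containing (e, 2, 1) for every positive integer e and closed under t_L and t_R. -/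
/-- A class-T triple `(d, n, a)`: positive integers with `n > a` and
`gcd(n, a) = 1`. -/
def IsClassT (t : ℤ × ℤ × ℤ) : Prop :=
  0 < t.1 ∧ 0 < t.2.2 ∧ t.2.2 < t.2.1 ∧ IsCoprime t.2.1 t.2.2

/-- The map `t_L(d, n, a) = (d, 2n − a, n)`. -/
def tL (t : ℤ × ℤ × ℤ) : ℤ × ℤ × ℤ := (t.1, 2 * t.2.1 - t.2.2, t.2.1)

/-- The map `t_R(d, n, a) = (d, n + a, a)`. -/
def tR (t : ℤ × ℤ × ℤ) : ℤ × ℤ × ℤ := (t.1, t.2.1 + t.2.2, t.2.2)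

def hjM (c : ℤ) : Matrix (Fin 2) (Fin 2) ℤ := !![c, -1; 1, 0]

def hjMat (L : List ℤ) : Matrix (Fin 2) (Fin 2) ℤ := (L.map hjM).prod

theorem hjMat_append (A B : List ℤ) : hjMat (A ++ B) = hjMat A * hjMat B := by
  simp [hjMat]

theorem hjMat_cons (c : ℤ) (B : List ℤ) : hjMat (c :: B) = hjM c * hjMat B := by
  simp [hjMat]

theorem hjMat_val (L : List ℤ) (h : ∀ c ∈ L, 2 ≤ c) :
    0 ≤ hjMat L 1 0 ∧ hjMat L 1 0 < hjMat L 0 0 ∧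
    (L ≠ [] → 0 < hjMat L 1 0 ∧ hjCF L = (hjMat L 0 0 : ℚ) / (hjMat L 1 0 : ℚ)) := by
  induction L with
  | nil => simp [hjMat]
  | cons c t ih =>
    obtain ⟨h1, h2, h3⟩ := ih (fun x hx => h x (List.mem_cons_of_mem _ hx))
    have hc : 2 ≤ c := h c (by simp)
    have e0 : hjMat (c :: t) 0 0 = c * hjMat t 0 0 - hjMat t 1 0 := by
      rw [hjMat_cons]; simp [hjM, Matrix.mul_apply, Fin.sum_univ_two]; ring
    have e1 : hjMat (c :: t) 1 0 = hjMat t 0 0 := by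
      rw [hjMat_cons]; simp [hjM, Matrix.mul_apply, Fin.sum_univ_two]
    rw [e0, e1]
    refine ⟨by linarith, by nlinarith, fun _ => ⟨by linarith, ?_⟩⟩
    cases t with
    | nil => simp [hjCF, hjMat]
    | cons c' t =>
      obtain ⟨h4, h5⟩ := h3 (by simp)
      rw [hjCF, h5]
      have : (0:ℚ) < (hjMat (c' :: t) 1 0 : ℚ) := by exact_mod_cast h4
      have : (0:ℚ) < (hjMat (c' :: t) 0 0 : ℚ) := by exact_mod_cast (h4.trans h2)
      push_cast
      field_simp

theorem hjCF_gt (L : List ℤ) (h : ∀ c ∈ L, 2 ≤ c) (hL : L ≠ []) : 1 < hjCF L := by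
  obtain ⟨_, h2, h3⟩ := hjMat_val L h
  obtain ⟨h4, h5⟩ := h3 hL
  rw [h5, one_lt_div (by exact_mod_cast h4)]
  exact_mod_cast h2

theorem hjCF_cons_bd (c : ℤ) (t : List ℤ) (h : ∀ x ∈ t, 2 ≤ x) :
    ∃ u : ℚ, 0 ≤ u ∧ u < 1 ∧ hjCF (c :: t) = c - u ∧
      (t = [] → u = 0) ∧ (t ≠ [] → 0 < u ∧ u = 1 / hjCF t) := by
  cases t with
  | nil => exact ⟨0, by simp [hjCF]⟩
  | cons c' t =>
    have := hjCF_gt (c' :: t) h (by simp)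
    have h0 : 0 < 1 / hjCF (c' :: t) := by positivity
    refine ⟨1 / hjCF (c' :: t), h0.le, ?_, rfl, by simp, fun _ => ⟨h0, rfl⟩⟩
    rw [div_lt_one (by linarith)]; exact this

theorem hjCF_inj (L : List ℤ) : ∀ L' : List ℤ, (∀ c ∈ L, 2 ≤ c) → (∀ c ∈ L', 2 ≤ c) →
    hjCF L = hjCF L' → L = L' := by
  induction L with
  | nil =>
    intro L' _ h' he
    by_contra hne
    have := hjCF_gt L' h' (fun h => hne h.symm)
    rw [← he] at this
    simp [hjCF] at this
  | cons c t ih =>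
    intro L' h h' he
    cases L' with
    | nil =>
      have := hjCF_gt _ h (by simp)
      rw [he] at this
      simp [hjCF] at this
    | cons c' t' =>
      have ht : ∀ x ∈ t, 2 ≤ x := fun x hx => h x (List.mem_cons_of_mem _ hx)
      have ht' : ∀ x ∈ t', 2 ≤ x := fun x hx => h' x (List.mem_cons_of_mem _ hx)
      obtain ⟨u, u0, u1, hu, ua, ub⟩ := hjCF_cons_bd c t ht
      obtain ⟨v, v0, v1, hv, va, vb⟩ := hjCF_cons_bd c' t' ht'
      rw [hu, hv] at he
      have e1 : c < c' + 1 := by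
        have : (c:ℚ) < c' + 1 := by linarith
        exact_mod_cast this
      have e2 : c' < c + 1 := by
        have : (c':ℚ) < c + 1 := by linarith
        exact_mod_cast this
      have hc : c = c' := by omega
      subst hc
      have huv : u = v := by linarith
      congr 1
      by_cases a : t = []
      · by_cases b : t' = []
        · rw [a, b]
        · have := ua a
          have := (vb b).1
          linarith
      · by_cases b : t' = []
        · have := va b
          have := (ub a).1
          linarith
        · apply ih t' ht ht'
          have h1 := (ub a).2
          have h2 := (vb b).2
          rw [h1, h2] at huv
          simpa using huv

def TM (d n a : ℤ) : Matrix (Fin 2) (Fin 2) ℤ :=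
  !![d * n ^ 2, -(d * n * (n - a) - 1); d * n * a - 1, -(d * a * (n - a) - 1)]

theorem hjMat_rep (k : ℕ) :
    hjMat (List.replicate k 2) = !![(k:ℤ) + 1, -(k:ℤ); (k:ℤ), 1 - (k:ℤ)] := by
  induction k with
  | zero => ext i j; fin_cases i <;> fin_cases j <;> simp [hjMat]
  | succ k ih =>
    rw [List.replicate_succ, hjMat_cons, ih, hjM, Matrix.mul_fin_two]
    push_cast
    congr! 1
    ext i j; fin_cases i <;> fin_cases j <;> simp <;> ring

theorem base_exists (d : ℤ) (hd : 0 < d) : ∃ L : List ℤ, (∀ c ∈ L, 2 ≤ c) ∧ L ≠ [] ∧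
    (L.length : ℤ) = d ∧ hjMat L = TM d 2 1 := by
  by_cases h1 : d = 1
  · subst h1
    refine ⟨[4], by simp, by simp, by simp, ?_⟩
    simp [hjMat, hjM, TM]
  · obtain ⟨k, rfl⟩ : ∃ k : ℕ, d = k + 2 := ⟨(d - 2).toNat, by omega⟩
    refine ⟨3 :: (List.replicate k 2 ++ [3]), ?_, by simp, ?_, ?_⟩
    · intro c hc
      simp at hc
      omega
    · simp; ring
    · have h3 : hjMat [3] = hjM 3 := by simp [hjMat]
      rw [hjMat_cons, hjMat_append, hjMat_rep, h3, hjM, TM, Matrix.mul_fin_two, Matrix.mul_fin_two]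
      ext i j; fin_cases i <;> fin_cases j <;> simp <;> ring

theorem stepR (d n a : ℤ) (L : List ℤ) (h : ∀ c ∈ L, 2 ≤ c) (hL : L ≠ [])
    (hM : hjMat L = TM d n a) :
    ∃ L' : List ℤ, (∀ c ∈ L', 2 ≤ c) ∧ L' ≠ [] ∧
    L'.length = L.length + 1 ∧ hjMat L' = TM d (n + a) a := by
  cases L with
  | nil => exact absurd rfl hL
  | cons c t =>
    refine ⟨(c + 1) :: t ++ [2], ?_, by simp, by simp, ?_⟩
    · intro x hx
      have hc := h c (by simp)
      simp at hx
      rcases hx with rfl | hx | rfl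
      · omega
      · exact h x (List.mem_cons_of_mem _ hx)
      · norm_num
    · have e : hjM (c + 1) = !![1, 1; 0, 1] * hjM c := by
        rw [hjM, hjM, Matrix.mul_fin_two]; simp
      have e2 : hjMat [2] = hjM 2 := by simp [hjMat]
      rw [hjMat_append, hjMat_cons, e, mul_assoc !![1, 1; 0, 1], ← hjMat_cons, hM, e2, hjM, TM, TM,
        Matrix.mul_fin_two, Matrix.mul_fin_two]
      ext i j; fin_cases i <;> fin_cases j <;> simp <;> ring

theorem stepL (d n a : ℤ) (L : List ℤ) (h : ∀ c ∈ L, 2 ≤ c) (hL : L ≠ [])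
    (hM : hjMat L = TM d n a) :
    ∃ L' : List ℤ, (∀ c ∈ L', 2 ≤ c) ∧ L' ≠ [] ∧
    L'.length = L.length + 1 ∧ hjMat L' = TM d (2 * n - a) n := by
  obtain ⟨t, c, rfl⟩ : ∃ t c, L = t ++ [c] :=
    ⟨L.dropLast, L.getLast hL, (List.dropLast_append_getLast hL).symm⟩
  refine ⟨2 :: (t ++ [c + 1]), ?_, by simp, by simp, ?_⟩
  · intro x hx
    have hc := h c (by simp)
    simp at hx
    rcases hx with rfl | hx | rfl
    · norm_num
    · exact h x (by simp [hx])
    · omega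
  · have e : hjMat [c + 1] = hjMat [c] * !![1, 0; -1, 1] := by
      simp [hjMat, hjM, Matrix.mul_fin_two]
    rw [hjMat_cons, hjMat_append, e, ← mul_assoc (hjMat t), ← hjMat_append, hM, hjM, TM, TM,
      Matrix.mul_fin_two, Matrix.mul_fin_two]
    ext i j; fin_cases i <;> fin_cases j <;> simp <;> first | ring1 | (ring_nf; simp)

theorem classT_main (N : ℕ) : ∀ d n a : ℤ, n.toNat ≤ N → IsClassT (d, n, a) →
    ∃ (fs : List (ℤ × ℤ × ℤ → ℤ × ℤ × ℤ)) (L : List ℤ),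
      (∀ f ∈ fs, f = tL ∨ f = tR) ∧ (∀ c ∈ L, 2 ≤ c) ∧ L ≠ [] ∧
      (fs.length : ℤ) = (L.length : ℤ) - d ∧ hjMat L = TM d n a ∧
      fs.foldr (fun f x => f x) (d, 2, 1) = (d, n, a) := by
  induction N with
  | zero =>
    rintro d n a hN ⟨h1, h2, h3, h4⟩
    simp at *
    omega
  | succ N ih =>
    rintro d n a hN ⟨h1, h2, h3, h4⟩
    simp only at h1 h2 h3 h4
    rcases lt_trichotomy (2 * a) n with hlt | heq | hgt
    · obtain ⟨fs, L, g1, g2, g3, g4, g5, g6⟩ := ih d (n - a) a (by omega)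
        ⟨h1, h2, by simp only; omega, by
          obtain ⟨x, y, hxy⟩ := h4
          exact ⟨x, x + y, by simp only; linear_combination hxy⟩⟩
      obtain ⟨L', k1, k2, k3, k4⟩ := stepR _ _ _ L g2 g3 g5
      refine ⟨tR :: fs, L', ?_, k1, k2, ?_, ?_, ?_⟩
      · simpa using g1
      · simp only [List.length_cons]; omega
      · rw [k4]; congr 1; ring
      · simp [g6, tR]
    · have : a = 1 := by
        obtain ⟨x, y, hxy⟩ := h4
        have : a ∣ 1 := ⟨2 * x + y, by rw [← hxy, ← heq]; ring⟩
        exact Int.eq_one_of_dvd_one h2.le this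
      obtain rfl := this
      obtain rfl : n = 2 := by omega
      obtain ⟨L, g1, g2, g3, g4⟩ := base_exists d h1
      exact ⟨[], L, by simp, g1, g2, by simp [g3], g4, by simp⟩
    · obtain ⟨fs, L, g1, g2, g3, g4, g5, g6⟩ := ih d a (2 * a - n) (by omega)
        ⟨h1, by simp only; omega, by simp only; omega, by
          obtain ⟨x, y, hxy⟩ := h4
          exact ⟨y + 2 * x, -x, by simp only; linear_combination hxy⟩⟩
      obtain ⟨L', k1, k2, k3, k4⟩ := stepL _ _ _ L g2 g3 g5
      refine ⟨tL :: fs, L', ?_, k1, k2, ?_, ?_, ?_⟩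
      · simpa using g1
      · simp only [List.length_cons]; omega
      · rw [k4]; congr 1; ring
      · simp [g6, tL]

/-- Corollary `corsub:going-up` of the paper: `t_L` and `t_R` send class-T
triples to class-T triples; every class-T triple `(d, n, a)` is obtained from
`(d, 2, 1)` by a composition of exactly `l − d` maps each equal to `t_L` or
`t_R`, where `l` is the length of the Hirzebruch–Jung expansion
`dn²/(dna − 1) = [b_1, …, b_l]`; and in particular the set of class-T triples
is the smallest set containing `(e, 2, 1)` for every positive integer `e` and
closed under `t_L` and `t_R`. -/
theorem classT_generated :
    (∀ t, IsClassT t → IsClassT (tL t) ∧ IsClassT (tR t)) ∧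
    (∀ e : ℤ, 0 < e → IsClassT (e, 2, 1)) ∧
    (∀ d n a : ℤ, IsClassT (d, n, a) →
      ∀ L : List ℤ, (∀ c ∈ L, 2 ≤ c) →
        ((d * n ^ 2 : ℤ) : ℚ) / ((d * n * a - 1 : ℤ) : ℚ) = hjCF L →
        ∃ fs : List (ℤ × ℤ × ℤ → ℤ × ℤ × ℤ),
          (∀ f ∈ fs, f = tL ∨ f = tR) ∧
          (fs.length : ℤ) = (L.length : ℤ) - d ∧
          fs.foldr (fun f x => f x) (d, 2, 1) = (d, n, a)) ∧
    (∀ S : Set (ℤ × ℤ × ℤ),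
      (∀ e : ℤ, 0 < e → (e, 2, 1) ∈ S) →
      (∀ t ∈ S, tL t ∈ S ∧ tR t ∈ S) →
      ∀ t, IsClassT t → t ∈ S) := by
  refine ⟨?_, ?_, ?_, ?_⟩
  · rintro ⟨d, n, a⟩ ⟨h1, h2, h3, x, y, hxy⟩
    simp only at h1 h2 h3 hxy
    refine ⟨⟨h1, by simp only [tL]; omega, by simp only [tL]; omega, -y, x + 2 * y, ?_⟩,
      ⟨h1, h2, by simp only [tR]; omega, x, y - x, ?_⟩⟩
    · simp only [tL]; linear_combination hxy
    · simp only [tR]; linear_combination hxy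
  · intro e he
    exact ⟨he, by norm_num, by norm_num, isCoprime_one_right⟩
  · intro d n a h L hL he
    obtain ⟨fs, L', g1, g2, g3, g4, g5, g6⟩ := classT_main _ d n a le_rfl h
    have hv := ((hjMat_val L' g2).2.2 g3).2
    have : hjCF L = hjCF L' := by
      rw [hv, ← he, g5]
      simp [TM]
    obtain rfl := hjCF_inj _ _ hL g2 this
    exact ⟨fs, g1, g4, g6⟩
  · rintro S hS hc ⟨d, n, a⟩ h
    obtain ⟨fs, L', g1, g2, g3, g4, g5, g6⟩ := classT_main _ d n a le_rfl h
    rw [← g6]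
    clear g4 g6
    induction fs with
    | nil => exact hS d h.1
    | cons f fs ih =>
      have := hc _ (ih (fun f hf => g1 f (List.mem_cons_of_mem _ hf)))
      rw [List.foldr_cons]
      rcases g1 f (by simp) with rfl | rfl
      · exact this.1
      · exact this.2
end
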